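/- arXiv:2302.04668 — 8 statements merged into one kernel-verified Lean document; each statement's English description precedes it below -/
import Mathlib

section
/- A function f : ℕ∞ → ℕ∞ preserves arbitrary suprema (i.e. f (sSup S) = sSup (f '' S) for every subset S of ℕ∞) if, and only if, f is monotone, f 0 = 0, and f ⊤ = ⨆ (n : ℕ), f n. -/
/-- A map `f : ℕ∞ → ℕ∞` preserves arbitrary suprema. -/
def PreservesSSup (f : ℕ∞ → ℕ∞) : Prop :=
  ∀ S : Set ℕ∞, f (sSup S) = sSup (f '' S)

theorem stmt0 (f : ℕ∞ → ℕ∞) :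
    PreservesSSup f ↔ Monotone f ∧ f 0 = 0 ∧ f ⊤ = ⨆ n : ℕ, f n := by
  constructor
  · intro h
    refine ⟨fun a b hab => ?_, ?_, ?_⟩
    · have hpair := h {a, b}
      rw [sSup_pair, sup_eq_right.mpr hab, Set.image_pair, sSup_pair] at hpair
      exact hpair ▸ le_sup_left
    · simpa using h ∅
    · have hrange := h (Set.range ((↑) : ℕ → ℕ∞))
      rwa [sSup_range, ENat.iSup_natCast, ← Set.range_comp, sSup_range] at hrange
  · rintro ⟨hmono, hzero, htop⟩ S
    refine le_antisymm ?_ (sSup_le (Set.forall_mem_image.mpr fun x hx => hmono (le_sSup hx)))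
    rcases S.eq_empty_or_nonempty with rfl | hne
    · simp [hzero]
    by_cases hS : sSup S = ⊤
    · rw [hS, htop]
      refine iSup_le fun n => ?_
      obtain ⟨x, hx, hnx⟩ := lt_sSup_iff.mp (hS ▸ ENat.natCast_lt_top n)
      exact (hmono hnx.le).trans (le_sSup (Set.mem_image_of_mem f hx))
    · have := hne.to_subtype
      exact le_sSup (Set.mem_image_of_mem f
        (ENat.sSup_mem_of_nonempty_of_lt_top (lt_top_iff_ne_top.mpr hS)))
end

section
/- Let C be a complete linear order and let res(C) be the set of maps C → C preserving arbitrary suprema. Let Θ be an equivalence relation on res(C) that is compatible with the pointwise infimum ⊓, the pointwise supremum ⊔, composition ∘, and the residual operations ⧵ and ⧸ (that is, if f Θ f' and g Θ g' then (f ⊓ g) Θ (f' ⊓ g'), (f ⊔ g) Θ (f' ⊔ g'), (f ∘ g) Θ (f' ∘ g'), (f ⧵ g) Θ (f' ⧵ g'), and (g ⧸ f) Θ (g' ⧸ f')). Then Θ is either the diagonal relation {(f,f) | f ∈ res(C)} or the full relation res(C) × res(C). -/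
/-- A map `f : C → C` on a complete linear order preserves arbitrary suprema. -/
def PresSSup {C : Type*} [CompleteLinearOrder C] (f : C → C) : Prop :=
  ∀ S : Set C, f (sSup S) = sSup (f '' S)

/-- The left residual `f ⧵ h`: the pointwise supremum of all suprema-preserving
maps `g` with `f ∘ g ≤ h` pointwise. -/
noncomputable def ldivF {C : Type*} [CompleteLinearOrder C] (f h : C → C) : C → C :=
  fun x => sSup {y | ∃ g : C → C, PresSSup g ∧ (∀ z, f (g z) ≤ h z) ∧ y = g x}

/-- The right residual `h ⧸ f`: the pointwise supremum of all suprema-preserving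
maps `g` with `g ∘ f ≤ h` pointwise. -/
noncomputable def rdivF {C : Type*} [CompleteLinearOrder C] (h f : C → C) : C → C :=
  fun x => sSup {y | ∃ g : C → C, PresSSup g ∧ (∀ z, g (f z) ≤ h z) ∧ y = g x}

lemma PresSSup.map_bot {C : Type*} [CompleteLinearOrder C] {f : C → C} (hf : PresSSup f) :
    f ⊥ = ⊥ := by
  simpa using hf ∅

lemma PresSSup.comp {C : Type*} [CompleteLinearOrder C] {f g : C → C} (hf : PresSSup f)
    (hg : PresSSup g) : PresSSup (f ∘ g) := fun S => by
  rw [Function.comp_apply, hg S, hf, Set.image_comp]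

open Classical in
/-- The step map sending `x` to `⊥` if `x ≤ a` and to `b` otherwise. -/
noncomputable def stepMap {C : Type*} [CompleteLinearOrder C] (a b : C) : C → C :=
  fun x => if x ≤ a then ⊥ else b

lemma stepMap_of_le {C : Type*} [CompleteLinearOrder C] {a x : C} (b : C) (h : x ≤ a) :
    stepMap a b x = ⊥ :=
  if_pos h

lemma stepMap_of_lt {C : Type*} [CompleteLinearOrder C] {a x : C} (b : C) (h : a < x) :
    stepMap a b x = b :=
  if_neg h.not_ge

lemma presSSup_stepMap {C : Type*} [CompleteLinearOrder C] (a b : C) :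
    PresSSup (stepMap a b) := by
  intro S
  rcases le_or_gt (sSup S) a with h | h
  · rw [stepMap_of_le b h, eq_comm, sSup_eq_bot]
    rintro _ ⟨x, hx, rfl⟩
    exact stepMap_of_le b ((le_sSup hx).trans h)
  · rw [stepMap_of_lt b h]
    obtain ⟨x, hx, hax⟩ := lt_sSup_iff.1 h
    refine le_antisymm (le_sSup ⟨x, hx, stepMap_of_lt b hax⟩) (sSup_le ?_)
    rintro _ ⟨y, -, rfl⟩
    rcases le_or_gt y a with hy | hy
    · simp [stepMap_of_le b hy]
    · exact (stepMap_of_lt b hy).le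

/-- Sandwiching a map between step maps detects whether its value at `a` exceeds `c`. -/
lemma stepMap_comp_comp_stepMap {C : Type*} [CompleteLinearOrder C] {f : C → C}
    (hf : PresSSup f) (a c d : C) :
    stepMap c d ∘ f ∘ stepMap ⊥ a = stepMap ⊥ (stepMap c d (f a)) := by
  funext x
  rcases le_or_gt x ⊥ with hx | hx
  · simp [stepMap_of_le _ hx, hf.map_bot, stepMap_of_le]
  · simp [stepMap_of_lt _ hx]

lemma PresSSup.le_stepMap_bot_top {C : Type*} [CompleteLinearOrder C] {f : C → C}
    (hf : PresSSup f) (x : C) : f x ≤ stepMap ⊥ ⊤ x := by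
  rcases le_or_gt x ⊥ with hx | hx
  · simp [le_bot_iff.1 hx, hf.map_bot]
  · simp [stepMap_of_lt _ hx]

/-- Any equivalence relation on `res(C)` compatible with pointwise meet, pointwise join,
composition, and the two residual operations is either the diagonal or the full relation. -/
theorem stmt2 {C : Type*} [CompleteLinearOrder C]
    (Θ : {f : C → C // PresSSup f} → {f : C → C // PresSSup f} → Prop)
    (hEquiv : Equivalence Θ)
    (hMeet : ∀ f f' g g' p p', Θ f f' → Θ g g' →
      p.1 = (fun x => f.1 x ⊓ g.1 x) → p'.1 = (fun x => f'.1 x ⊓ g'.1 x) → Θ p p')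
    (hJoin : ∀ f f' g g' p p', Θ f f' → Θ g g' →
      p.1 = (fun x => f.1 x ⊔ g.1 x) → p'.1 = (fun x => f'.1 x ⊔ g'.1 x) → Θ p p')
    (hComp : ∀ f f' g g' p p', Θ f f' → Θ g g' →
      p.1 = f.1 ∘ g.1 → p'.1 = f'.1 ∘ g'.1 → Θ p p')
    (hLdiv : ∀ f f' g g' p p', Θ f f' → Θ g g' →
      p.1 = ldivF f.1 g.1 → p'.1 = ldivF f'.1 g'.1 → Θ p p')
    (hRdiv : ∀ f f' g g' p p', Θ f f' → Θ g g' →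
      p.1 = rdivF g.1 f.1 → p'.1 = rdivF g'.1 f'.1 → Θ p p') :
    (∀ f g, Θ f g ↔ f = g) ∨ (∀ f g, Θ f g) := by
  let step (a b : C) : {f : C → C // PresSSup f} := ⟨stepMap a b, presSSup_stepMap a b⟩
  have collapse : ∀ f g a, Θ f g → f.1 a < g.1 a → ∀ h, Θ (step ⊥ ⊥) h := by
    intro f g a hfg hlt h
    have hbt : Θ (step ⊥ ⊥) (step ⊥ ⊤) := by
      refine hComp (step (f.1 a) ⊤) (step (f.1 a) ⊤) ⟨_, f.2.comp (presSSup_stepMap ⊥ a)⟩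
        ⟨_, g.2.comp (presSSup_stepMap ⊥ a)⟩ _ _ (hEquiv.refl _)
        (hComp f g (step ⊥ a) (step ⊥ a) _ _ hfg (hEquiv.refl _) rfl rfl) ?_ ?_
      · exact ((stepMap_comp_comp_stepMap f.2 a (f.1 a) ⊤).trans
          (by rw [stepMap_of_le _ le_rfl])).symm
      · exact ((stepMap_comp_comp_stepMap g.2 a (f.1 a) ⊤).trans
          (by rw [stepMap_of_lt _ hlt])).symm
    refine hMeet h h (step ⊥ ⊥) (step ⊥ ⊤) _ _ (hEquiv.refl h) hbt ?_ ?_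
    · funext x
      simp [step, stepMap]
    · funext x
      exact (inf_eq_left.2 (h.2.le_stepMap_bot_top x)).symm
  by_cases hdiag : ∀ f g, Θ f g → f = g
  · exact Or.inl fun f g => ⟨hdiag f g, fun h => h ▸ hEquiv.refl f⟩
  · push Not at hdiag
    obtain ⟨f, g, hfg, hne⟩ := hdiag
    obtain ⟨a, ha⟩ := Function.ne_iff.1 fun h => hne (Subtype.ext h)
    have hbot : ∀ h, Θ (step ⊥ ⊥) h := by
      rcases lt_or_gt_of_ne ha with hlt | hlt
      · exact collapse f g a hfg hlt
      · exact collapse g f a (hEquiv.symm hfg) hlt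
    exact Or.inr fun p q => hEquiv.trans (hEquiv.symm (hbot p)) (hbot q)
end

section
/- Let f be a time warp and define h : ℕ∞ → ℕ∞ by h m = ⨅ {pred n | n ∈ ℕ∞, m ≤ f n} (with ⨅ ∅ = ⊤). Then h is a time warp, f ∘ h ≤ pred pointwise, and h is the greatest such map: for every time warp g with f ∘ g ≤ pred pointwise, g ≤ h pointwise. In particular h = f ⧵ pred, the right residual of pred by f. -/
/-- The predecessor time warp: `pred 0 = 0`, `pred ⊤ = ⊤`, `pred (n+1) = n`. -/
def wpred (m : ℕ∞) : ℕ∞ := if m = ⊤ then ⊤ else ((m.toNat - 1 : ℕ) : ℕ∞)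

theorem wpred_le_coe_iff {m : ℕ∞} {k : ℕ} : wpred m ≤ k ↔ m ≤ k + 1 := by
  induction m with
  | top => simp [wpred]
  | coe n =>
    simp only [wpred, ENat.natCast_ne_top, if_false, ENat.toNat_natCast]
    norm_cast
    omega

theorem le_of_forall_le_coe {a b : ℕ∞} (hab : ∀ c : ℕ, b ≤ c → a ≤ c) : a ≤ b := by
  induction b with
  | top => exact le_top
  | coe n => exact hab n le_rfl

namespace PreservesSSup

variable {f : ℕ∞ → ℕ∞}

theorem map_zero (hf : PreservesSSup f) : f 0 = 0 := by
  simpa using hf ∅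

theorem monotone (hf : PreservesSSup f) : Monotone f := by
  intro a b hab
  have hpair := hf {a, b}
  rw [Set.image_pair, sSup_pair, sSup_pair, sup_eq_right.2 hab] at hpair
  exact hpair ▸ le_sup_left

theorem exists_coe_lt_apply (hf : PreservesSSup f) {m : ℕ∞} {k : ℕ∞} (hk : k < f m) :
    ∃ c : ℕ, (c : ℕ∞) ≤ m ∧ k < f c := by
  induction m with
  | coe n => exact ⟨n, le_rfl, hk⟩
  | top =>
    have htop : sSup (Set.range ((↑) : ℕ → ℕ∞)) = ⊤ := by
      rw [sSup_range, ENat.iSup_natCast]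
    rw [← htop, hf, lt_sSup_iff] at hk
    obtain ⟨_, ⟨_, ⟨c, rfl⟩, rfl⟩, hc⟩ := hk
    exact ⟨c, le_top, hc⟩

end PreservesSSup

theorem sInf_wpred_le_coe_iff {f : ℕ∞ → ℕ∞} (hf : Monotone f) {m : ℕ∞} {c : ℕ} :
    sInf {y | ∃ n : ℕ∞, m ≤ f n ∧ y = wpred n} ≤ c ↔ m ≤ f (c + 1) := by
  constructor
  · intro hle
    obtain ⟨_, ⟨n, hn, rfl⟩, hlt⟩ :=
      sInf_lt_iff.1 (hle.trans_lt (ENat.natCast_lt_succ (n := c)))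
    exact hn.trans (hf (wpred_le_coe_iff.1 (Order.le_of_lt_add_one hlt)))
  · intro hle
    exact sInf_le_of_le ⟨_, hle, rfl⟩ (wpred_le_coe_iff.2 le_rfl)

theorem stmt3 (f : ℕ∞ → ℕ∞) (hf : PreservesSSup f)
    (h : ℕ∞ → ℕ∞)
    (hdef : ∀ m, h m = sInf {y | ∃ n : ℕ∞, m ≤ f n ∧ y = wpred n}) :
    PreservesSSup h ∧
    (∀ m, f (h m) ≤ wpred m) ∧
    (∀ g : ℕ∞ → ℕ∞, PreservesSSup g → (∀ m, f (g m) ≤ wpred m) → ∀ m, g m ≤ h m) ∧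
    (∀ m, h m = sSup {y | ∃ g : ℕ∞ → ℕ∞, PreservesSSup g ∧
      (∀ z, f (g z) ≤ wpred z) ∧ y = g m}) := by
  have key : ∀ (m : ℕ∞) (c : ℕ), h m ≤ c ↔ m ≤ f (c + 1) := fun m c => by
    rw [hdef, sInf_wpred_le_coe_iff hf.monotone]
  have h_sup : PreservesSSup h := by
    intro S
    have hS : ∀ c : ℕ, h (sSup S) ≤ c ↔ sSup (h '' S) ≤ c := fun c => by
      simp only [key, sSup_le_iff, Set.forall_mem_image]
    exact le_antisymm (le_of_forall_le_coe fun c => (hS c).2)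
      (le_of_forall_le_coe fun c => (hS c).1)
  have h_comp : ∀ m, f (h m) ≤ wpred m := by
    refine fun m => le_of_forall_le_coe fun k hk => ?_
    by_contra! hlt
    obtain ⟨c, hc, hkc⟩ := hf.exists_coe_lt_apply hlt
    cases c with
    | zero => simp [hf.map_zero] at hkc
    | succ c =>
      have hm : m ≤ f (c + 1) :=
        (wpred_le_coe_iff.1 hk).trans (by simpa using Order.add_one_le_of_lt hkc)
      have hle : ((c + 1 : ℕ) : ℕ∞) ≤ c := hc.trans ((key m c).2 hm)
      norm_cast at hle
      omega
  have h_greatest : ∀ g : ℕ∞ → ℕ∞, PreservesSSup g → (∀ m, f (g m) ≤ wpred m) →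
      ∀ m, g m ≤ h m := by
    refine fun g hg hfg m => le_of_forall_le_coe fun c hc => ?_
    by_contra! hlt
    obtain ⟨k, hkm, hck⟩ := hg.exists_coe_lt_apply hlt
    cases k with
    | zero => simp [hg.map_zero] at hck
    | succ k =>
      have hle : ((k + 1 : ℕ) : ℕ∞) ≤ k :=
        calc ((k + 1 : ℕ) : ℕ∞) ≤ f (c + 1) := hkm.trans ((key m c).1 hc)
          _ ≤ f (g (k + 1 : ℕ)) := hf.monotone (Order.add_one_le_of_lt hck)
          _ ≤ wpred (k + 1 : ℕ) := hfg _
          _ ≤ k := wpred_le_coe_iff.2 (by simp)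
      norm_cast at hle
      omega
  refine ⟨h_sup, h_comp, h_greatest, fun m => le_antisymm ?_ ?_⟩
  · exact le_sSup ⟨h, h_sup, h_comp, rfl⟩
  · refine sSup_le ?_
    rintro _ ⟨g, hg, hfg, rfl⟩
    exact h_greatest g hg hfg m
end

section
/- Let succ : ℕ∞ → ℕ∞ be defined by succ 0 = 0, succ ⊤ = ⊤, and succ m = m + 1 for m : ℕ with m ≥ 1. Then succ is a time warp, pred ∘ succ = id, pred ∘ g ≤ id pointwise implies g ≤ succ for every time warp g, and succ m = ⨅ {pred n | n ∈ ℕ∞, m ≤ pred (pred n)} for every m ∈ ℕ∞ (i.e. succ is the involution of pred ∘ pred). -/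
/-- The successor time warp: `succ 0 = 0`, `succ ⊤ = ⊤`, `succ m = m + 1` for `1 ≤ m < ⊤`. -/
def wsucc (m : ℕ∞) : ℕ∞ := if m = ⊤ then ⊤ else if m = 0 then 0 else m + 1

theorem wsucc_le_iff (m y : ℕ∞) : wsucc m ≤ y ↔ m ≤ wpred y := by
  induction m using ENat.recTopCoe with
  | top => induction y using ENat.recTopCoe <;> simp [wsucc, wpred]
  | coe m =>
    induction y using ENat.recTopCoe with
    | top => simp [wpred]
    | coe y =>
      rcases Nat.eq_zero_or_pos m with rfl | hm
      · simp [wsucc]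
      · have hm0 : (m : ℕ∞) ≠ 0 := by exact_mod_cast hm.ne'
        rw [wsucc, if_neg (ENat.natCast_ne_top m), if_neg hm0, wpred,
          if_neg (ENat.natCast_ne_top y), ENat.toNat_natCast]
        norm_cast
        omega

theorem gc_wsucc_wpred : GaloisConnection wsucc wpred := wsucc_le_iff

theorem wpred_wsucc (m : ℕ∞) : wpred (wsucc m) = m := by
  induction m using ENat.recTopCoe with
  | top => simp [wsucc, wpred]
  | coe m =>
    rcases Nat.eq_zero_or_pos m with rfl | hm
    · simp [wsucc, wpred]
    · have hm0 : (m : ℕ∞) ≠ 0 := by exact_mod_cast hm.ne'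
      rw [wsucc, if_neg (ENat.natCast_ne_top m), if_neg hm0, ← Nat.cast_add_one, wpred,
        if_neg (ENat.natCast_ne_top _), ENat.toNat_natCast, Nat.add_sub_cancel]

theorem le_wsucc_of_wpred_le {m y : ℕ∞} (hm : m ≠ 0) (h : wpred y ≤ m) : y ≤ wsucc m := by
  induction m using ENat.recTopCoe with
  | top => simp [wsucc]
  | coe m =>
    rw [wsucc, if_neg (ENat.natCast_ne_top m), if_neg hm]
    induction y using ENat.recTopCoe with
    | top => simp [wpred] at h
    | coe y =>
      rw [wpred, if_neg (ENat.natCast_ne_top y), ENat.toNat_natCast] at h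
      norm_cast at h ⊢
      omega

theorem PreservesSSup.map_zero_s4 {g : ℕ∞ → ℕ∞} (hg : PreservesSSup g) : g 0 = 0 := by
  simpa using hg ∅

theorem stmt4 :
    PreservesSSup wsucc ∧
    wpred ∘ wsucc = id ∧
    (∀ g : ℕ∞ → ℕ∞, PreservesSSup g → (∀ m, wpred (g m) ≤ id m) → ∀ m, g m ≤ wsucc m) ∧
    (∀ m, wsucc m = sInf {y | ∃ n : ℕ∞, m ≤ wpred (wpred n) ∧ y = wpred n}) := by
  refine ⟨fun S => ?_, funext wpred_wsucc, fun g hg h m => ?_, fun m => le_antisymm ?_ ?_⟩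
  · rw [gc_wsucc_wpred.l_sSup, sSup_image]
  · rcases eq_or_ne m 0 with rfl | hm
    · simp [hg.map_zero_s4]
    · exact le_wsucc_of_wpred_le hm (h m)
  · refine le_sInf ?_
    rintro _ ⟨n, hn, rfl⟩
    exact (wsucc_le_iff _ _).2 hn
  · exact sInf_le ⟨wsucc (wsucc m), by simp only [wpred_wsucc, le_refl], (wpred_wsucc _).symm⟩
end

section
/- If f is a regular time warp, then its involution f⋆ is a regular time warp. -/
/-- The involution `f⋆` of a time warp `f`: `f⋆ m = ⨅ {pred n | n ∈ ℕ∞, m ≤ f n}`. -/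
noncomputable def winv (f : ℕ∞ → ℕ∞) : ℕ∞ → ℕ∞ :=
  fun m => sInf {y | ∃ n : ℕ∞, m ≤ f n ∧ y = wpred n}

/-- `f` is eventually constant: from some `m : ℕ` on, `f` takes the value `f m`. -/
def EventuallyConstant (f : ℕ∞ → ℕ∞) : Prop :=
  ∃ m : ℕ, ∀ n : ℕ, m ≤ n → f n = f m

/-- `f` is eventually linear: there are `m : ℕ` and `k : ℤ` with `f n = n + k`
for all natural `n ≥ m`. -/
def EventuallyLinear (f : ℕ∞ → ℕ∞) : Prop :=
  ∃ (m : ℕ) (k : ℤ), ∀ n : ℕ, m ≤ n → ∃ j : ℕ, f n = (j : ℕ∞) ∧ (j : ℤ) = (n : ℤ) + k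

/-- `f` is regular: eventually constant or eventually linear. -/
def RegularW (f : ℕ∞ → ℕ∞) : Prop := EventuallyConstant f ∨ EventuallyLinear f

theorem PreservesSSup.monotone_s7 {f : ℕ∞ → ℕ∞} (hf : PreservesSSup f) : Monotone f := by
  intro a b hab
  have h := hf {a, b}
  rw [sSup_pair, sup_eq_right.2 hab, Set.image_pair, sSup_pair] at h
  rw [h]
  exact le_sup_left

theorem le_iff_forall_le_natCast {a b : ℕ∞} : a ≤ b ↔ ∀ k : ℕ, b ≤ k → a ≤ k := by
  refine ⟨fun h k hk => h.trans hk, fun h => ?_⟩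
  induction b using ENat.recTopCoe with
  | top => exact le_top
  | coe b => exact h b le_rfl

theorem eq_of_forall_le_natCast_iff {a b : ℕ∞} (h : ∀ k : ℕ, a ≤ k ↔ b ≤ k) : a = b :=
  le_antisymm (le_iff_forall_le_natCast.2 fun k => (h k).2)
    (le_iff_forall_le_natCast.2 fun k => (h k).1)

theorem wpred_le_natCast_iff {n : ℕ∞} {k : ℕ} : wpred n ≤ k ↔ n ≤ (k + 1 : ℕ) := by
  induction n using ENat.recTopCoe with
  | top => simp [wpred, -Nat.cast_add]
  | coe n =>
    simp only [wpred, ENat.natCast_ne_top, if_false, ENat.toNat_natCast, Nat.cast_le]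
    omega

theorem winv_le_natCast_iff {f : ℕ∞ → ℕ∞} (hf : Monotone f) {m : ℕ∞} {k : ℕ} :
    winv f m ≤ k ↔ m ≤ f (k + 1 : ℕ) := by
  constructor
  · intro h
    have hlt : winv f m < (k + 1 : ℕ) := h.trans_lt (Nat.cast_lt.2 k.lt_succ_self)
    rw [winv, sInf_lt_iff] at hlt
    obtain ⟨_, ⟨n, hn, rfl⟩, hy⟩ := hlt
    have hle : wpred n ≤ k := Order.le_of_lt_add_one (by simpa using hy)
    exact hn.trans (hf (wpred_le_natCast_iff.1 hle))
  · intro h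
    have hle : winv f m ≤ wpred (k + 1 : ℕ) := sInf_le ⟨_, h, rfl⟩
    exact hle.trans (wpred_le_natCast_iff.2 le_rfl)

theorem preservesSSup_winv {f : ℕ∞ → ℕ∞} (hf : Monotone f) : PreservesSSup (winv f) := by
  intro S
  refine eq_of_forall_le_natCast_iff fun k => ?_
  simp [winv_le_natCast_iff hf, sSup_le_iff, -Nat.cast_add]

theorem eventuallyConstant_winv {f : ℕ∞ → ℕ∞} (hf : Monotone f) (hc : EventuallyConstant f) :
    EventuallyConstant (winv f) := by
  obtain ⟨m, hm⟩ := hc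
  set P : ℕ := ∑ i ∈ Finset.range (m + 1), (f i).toNat + 1 with hP
  have hbound : ∀ j : ℕ, f j ≠ ⊤ → f j < (P : ℕ∞) := by
    intro j hj
    obtain ⟨i, hi, hij⟩ : ∃ i ∈ Finset.range (m + 1), f j = f i := by
      rcases le_total m j with h | h
      · exact ⟨m, by simp, hm j h⟩
      · exact ⟨j, by simpa using Nat.lt_succ_of_le h, rfl⟩
    have hle := Finset.single_le_sum (f := fun i : ℕ => (f i).toNat)
      (fun _ _ => Nat.zero_le _) hi
    rw [hij] at hj ⊢
    rw [← ENat.natCast_toNat hj, Nat.cast_lt]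
    exact Nat.lt_succ_of_le hle
  have htop : ∀ p : ℕ, P ≤ p → ∀ j : ℕ, (p : ℕ∞) ≤ f j ↔ f j = ⊤ := by
    refine fun p hp j => ⟨fun h => ?_, fun h => h ▸ le_top⟩
    by_contra hj
    exact absurd ((Nat.cast_le.2 hp).trans h) (hbound j hj).not_ge
  refine ⟨P, fun p hp => eq_of_forall_le_natCast_iff fun k => ?_⟩
  rw [winv_le_natCast_iff hf, winv_le_natCast_iff hf, htop p hp, htop P le_rfl]

theorem eventuallyLinear_winv {f : ℕ∞ → ℕ∞} (hf : Monotone f) (hl : EventuallyLinear f) :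
    EventuallyLinear (winv f) := by
  obtain ⟨m, k, hk⟩ := hl
  refine ⟨((m : ℤ) + k + 1).toNat, -k - 1, fun p hp => ?_⟩
  refine ⟨((p : ℤ) + (-k - 1)).toNat, eq_of_forall_le_natCast_iff fun j => ?_, by omega⟩
  rw [winv_le_natCast_iff hf, Nat.cast_le]
  rcases le_total m (j + 1) with h | h
  · obtain ⟨i, hi, hik⟩ := hk (j + 1) h
    rw [hi, Nat.cast_le]
    push_cast at hik
    omega
  · obtain ⟨i, hi, hik⟩ := hk m le_rfl
    have hle : f (j + 1 : ℕ) ≤ i := hi ▸ hf (Nat.cast_le.2 h)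
    refine ⟨fun hp' => ?_, fun _ => ?_⟩
    · have := Nat.cast_le.1 (hp'.trans hle)
      omega
    · omega

theorem stmt7 (f : ℕ∞ → ℕ∞) (hf : PreservesSSup f) (hreg : RegularW f) :
    PreservesSSup (winv f) ∧ RegularW (winv f) :=
  ⟨preservesSSup_winv hf.monotone_s7,
    hreg.imp (eventuallyConstant_winv hf.monotone_s7) (eventuallyLinear_winv hf.monotone_s7)⟩
end

section
/- For every time warp f, every natural number n ≥ 1, and every natural number m (all viewed in ℕ∞): (a) f⋆ n = m if, and only if, f m < n and n ≤ f (m+1); (b) f⋆ ⊤ = m if, and only if, f m < ⊤ and f (m+1) = ⊤; (c) f⋆ n = ⊤ if, and only if, f ⊤ < n; (d) f⋆ ⊤ = ⊤ if, and only if, f ⊤ < ⊤ or last f = ⊤. -/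
/-- `last f = sInf {m | f m = f ⊤}`. -/
noncomputable def wlast (f : ℕ∞ → ℕ∞) : ℕ∞ := sInf {m | f m = f ⊤}

namespace PreservesSSup

variable {f : ℕ∞ → ℕ∞}

theorem map_top (hf : PreservesSSup f) : f ⊤ = ⨆ k : ℕ, f k := by
  have h := hf (Set.range ((↑) : ℕ → ℕ∞))
  have htop : ⨆ k : ℕ, (k : ℕ∞) = ⊤ :=
    ENat.eq_top_iff_forall_ge.2 fun k => le_iSup (fun k : ℕ => (k : ℕ∞)) k
  rwa [sSup_range, htop, ← Set.range_comp, sSup_range] at h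

theorem natCast_le_map_top_iff (hf : PreservesSSup f) {n : ℕ} (hn : 1 ≤ n) :
    (n : ℕ∞) ≤ f ⊤ ↔ ∃ k : ℕ, (n : ℕ∞) ≤ f k := by
  refine ⟨fun h => ?_, fun ⟨k, hk⟩ => hk.trans (hf.monotone le_top)⟩
  have h' : ((n - 1 : ℕ) : ℕ∞) < ⨆ k : ℕ, f k :=
    lt_of_lt_of_le (by exact_mod_cast Nat.sub_lt hn one_pos) (hf.map_top ▸ h)
  obtain ⟨k, hk⟩ := lt_iSup_iff.1 h'
  refine ⟨k, ?_⟩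
  have := Order.add_one_le_of_lt hk
  rwa [← Nat.cast_add_one, Nat.sub_add_cancel hn] at this

end PreservesSSup

theorem wpred_natCast (k : ℕ) : wpred k = ((k - 1 : ℕ) : ℕ∞) := by
  simp [wpred]

theorem winv_lt_natCast_iff {f : ℕ∞ → ℕ∞} (hf : PreservesSSup f) {x : ℕ∞} (hx : x ≠ 0) (k : ℕ) :
    winv f x < k ↔ x ≤ f k := by
  rw [winv, sInf_lt_iff]
  constructor
  · rintro ⟨_, ⟨a, ha, rfl⟩, hlt⟩
    refine ha.trans (hf.monotone ?_)
    induction a using ENat.recTopCoe with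
    | top => simp [wpred] at hlt
    | coe a =>
      rw [wpred_natCast, Nat.cast_lt] at hlt
      exact_mod_cast (by omega : a ≤ k)
  · intro h
    refine ⟨wpred k, ⟨k, h, rfl⟩, ?_⟩
    have hk : k ≠ 0 := by
      rintro rfl
      rw [Nat.cast_zero, hf.map_zero] at h
      exact hx (nonpos_iff_eq_zero.1 h)
    rw [wpred_natCast, Nat.cast_lt]
    omega

theorem winv_eq_natCast_iff {f : ℕ∞ → ℕ∞} (hf : PreservesSSup f) {x : ℕ∞} (hx : x ≠ 0) (m : ℕ) :
    winv f x = m ↔ f m < x ∧ x ≤ f ((m : ℕ∞) + 1) := by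
  have h := winv_lt_natCast_iff hf hx (m + 1)
  rw [Nat.cast_add_one, ENat.lt_add_one_iff (ENat.natCast_ne_top m)] at h
  rw [← h, ← not_le, ← winv_lt_natCast_iff hf hx m, not_lt, and_comm]
  exact le_antisymm_iff

theorem winv_eq_top_iff {f : ℕ∞ → ℕ∞} (hf : PreservesSSup f) {x : ℕ∞} (hx : x ≠ 0) :
    winv f x = ⊤ ↔ ∀ k : ℕ, f k < x := by
  rw [ENat.eq_top_iff_forall_ge]
  refine forall_congr' fun k => ?_
  rw [← not_lt, winv_lt_natCast_iff hf hx, not_le]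

theorem wlast_eq_top_iff (f : ℕ∞ → ℕ∞) : wlast f = ⊤ ↔ ∀ k : ℕ, f k ≠ f ⊤ := by
  rw [wlast, sInf_eq_top]
  constructor
  · intro h k hk
    exact ENat.natCast_ne_top k (h k hk)
  · intro h a ha
    induction a using ENat.recTopCoe with
    | top => rfl
    | coe a => exact absurd ha (h a)

theorem stmt10 (f : ℕ∞ → ℕ∞) (hf : PreservesSSup f) (n : ℕ) (hn : 1 ≤ n) (m : ℕ) :
    (winv f n = m ↔ f m < n ∧ (n : ℕ∞) ≤ f ((m : ℕ∞) + 1)) ∧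
    (winv f ⊤ = m ↔ f m < ⊤ ∧ f ((m : ℕ∞) + 1) = ⊤) ∧
    (winv f n = ⊤ ↔ f ⊤ < n) ∧
    (winv f ⊤ = ⊤ ↔ f ⊤ < ⊤ ∨ wlast f = ⊤) := by
  have hn0 : (n : ℕ∞) ≠ 0 := by exact_mod_cast Nat.one_le_iff_ne_zero.1 hn
  refine ⟨winv_eq_natCast_iff hf hn0 m, ?_, ?_, ?_⟩
  · rw [winv_eq_natCast_iff hf ENat.top_ne_zero, top_le_iff]
  · rw [winv_eq_top_iff hf hn0, ← not_le, hf.natCast_le_map_top_iff hn]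
    push Not
    rfl
  · rw [winv_eq_top_iff hf ENat.top_ne_zero, wlast_eq_top_iff]
    by_cases h : f ⊤ = ⊤
    · simp [h, lt_top_iff_ne_top]
    · have h' : f ⊤ < ⊤ := lt_top_iff_ne_top.2 h
      exact iff_of_true (fun k => (hf.monotone le_top).trans_lt h') (Or.inl h')
end

section
/- For every sample α, the set {β : Sample | α ⤳* β} is finite, where ⤳* is the reflexive-transitive closure of ⤳. Consequently, the saturation of any finite set of samples is finite. -/
/-- Terms in the language of the time warp algebra. -/
inductive Term : Type
  | var : ℕ → Term
  | one : Term
  | mul : Term → Term → Term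
  | star : Term → Term
  | meet : Term → Term → Term
  | join : Term → Term → Term

/-- Basic terms: built only from variables, `one`, `mul`, and `star`. -/
inductive IsBasic : Term → Prop
  | var (i : ℕ) : IsBasic (Term.var i)
  | one : IsBasic Term.one
  | mul {t u : Term} : IsBasic t → IsBasic u → IsBasic (Term.mul t u)
  | star {t : Term} : IsBasic t → IsBasic (Term.star t)

/-- The type of basic terms. -/
def BasicTerm : Type := {t : Term // IsBasic t}

/-- Product of basic terms. -/
def BasicTerm.mul (t u : BasicTerm) : BasicTerm := ⟨Term.mul t.1 u.1, IsBasic.mul t.2 u.2⟩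

/-- Star of a basic term. -/
def BasicTerm.star (t : BasicTerm) : BasicTerm := ⟨Term.star t.1, IsBasic.star t.2⟩

/-- The unit basic term. -/
def BasicTerm.one : BasicTerm := ⟨Term.one, IsBasic.one⟩

/-- Samples: time variables `κ i`, applications `t[α]`, successors `suc α`,
and `last t` for basic terms `t`. -/
inductive Sample : Type
  | kappa : ℕ → Sample
  | app : BasicTerm → Sample → Sample
  | suc : Sample → Sample
  | lst : BasicTerm → Sample

/-- The one-step relation `⤳` on samples. -/
inductive Step : Sample → Sample → Prop
  | appDrop (t : BasicTerm) (α : Sample) : Step (Sample.app t α) α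
  | sucDrop (α : Sample) : Step (Sample.suc α) α
  | toLast (t : BasicTerm) (α : Sample) : Step (Sample.app t α) (Sample.app t (Sample.lst t))
  | mulSplit (t u : BasicTerm) (α : Sample) :
      Step (Sample.app (t.mul u) α) (Sample.app t (Sample.app u α))
  | starLow (t : BasicTerm) (α : Sample) :
      Step (Sample.app t.star α) (Sample.app t (Sample.app t.star α))
  | starHigh (t : BasicTerm) (α : Sample) :
      Step (Sample.app t.star α) (Sample.app t (Sample.suc (Sample.app t.star α)))

/-- `F` is closed under `Step`, except that steps may leave `F` through `α`. -/
def ClosedUpTo (α : Sample) (F : Set Sample) : Prop :=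
  ∀ β ∈ F, ∀ γ, Step β γ → γ ∈ F ∨ γ = α

theorem step_app_cases {t : BasicTerm} {α γ : Sample} (h : Step (Sample.app t α) γ) :
    γ = α ∨ γ = Sample.app t (Sample.lst t) ∨
      (∃ u v : BasicTerm, t = u.mul v ∧ γ = Sample.app u (Sample.app v α)) ∨
      ∃ u : BasicTerm, t = u.star ∧
        (γ = Sample.app u (Sample.app t α) ∨ γ = Sample.app u (Sample.suc (Sample.app t α))) := by
  cases h with
  | appDrop => exact Or.inl rfl
  | toLast => exact Or.inr (Or.inl rfl)
  | mulSplit u v => exact Or.inr (Or.inr (Or.inl ⟨u, v, rfl, rfl⟩))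
  | starLow u => exact Or.inr (Or.inr (Or.inr ⟨u, rfl, Or.inl rfl⟩))
  | starHigh u => exact Or.inr (Or.inr (Or.inr ⟨u, rfl, Or.inr rfl⟩))

theorem not_step_lst {t : BasicTerm} {γ : Sample} : ¬ Step (Sample.lst t) γ := nofun

theorem not_step_kappa {i : ℕ} {γ : Sample} : ¬ Step (Sample.kappa i) γ := nofun

theorem eq_of_step_suc {α γ : Sample} (h : Step (Sample.suc α) γ) : γ = α := by
  cases h; rfl

theorem BasicTerm.mul_inj {t u t' u' : BasicTerm} (h : t.mul u = t'.mul u') :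
    t = t' ∧ u = u' := by
  have h' := congrArg Subtype.val h
  simp only [BasicTerm.mul, Term.mul.injEq] at h'
  exact ⟨Subtype.ext h'.1, Subtype.ext h'.2⟩

theorem BasicTerm.star_inj {t t' : BasicTerm} (h : t.star = t'.star) : t = t' := by
  have h' := congrArg Subtype.val h
  simp only [BasicTerm.star, Term.star.injEq] at h'
  exact Subtype.ext h'

theorem BasicTerm.mul_ne_star {t u v : BasicTerm} : t.mul u ≠ v.star :=
  fun h => Term.noConfusion (congrArg Subtype.val h)

/-- A basic term `t` such that every `t[α]` lies in a finite set closed up to `α`. -/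
def FinitelyUnfolds (t : BasicTerm) : Prop :=
  ∀ α, ∃ F : Set Sample, F.Finite ∧ Sample.app t α ∈ F ∧ ClosedUpTo α F

theorem finitelyUnfolds_of_irreducible {t : BasicTerm}
    (hmul : ∀ u v : BasicTerm, t ≠ u.mul v) (hstar : ∀ u : BasicTerm, t ≠ u.star) :
    FinitelyUnfolds t := by
  intro α
  refine ⟨{Sample.app t α, Sample.app t (Sample.lst t), Sample.lst t}, by simp, by simp, ?_⟩
  rintro β (rfl | rfl | rfl) γ h
  · rcases step_app_cases h with rfl | rfl | ⟨u, v, e, -⟩ | ⟨u, e, -⟩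
    · simp
    · simp
    · exact absurd e (hmul u v)
    · exact absurd e (hstar u)
  · rcases step_app_cases h with rfl | rfl | ⟨u, v, e, -⟩ | ⟨u, e, -⟩
    · simp
    · simp
    · exact absurd e (hmul u v)
    · exact absurd e (hstar u)
  · exact absurd h not_step_lst

theorem FinitelyUnfolds.mul {t u : BasicTerm} (ht : FinitelyUnfolds t) (hu : FinitelyUnfolds u) :
    FinitelyUnfolds (t.mul u) := by
  choose F hFfin hFmem hFclosed using ht
  choose G hGfin hGmem hGclosed using hu
  intro α
  let l := Sample.lst (t.mul u)
  refine ⟨{Sample.app (t.mul u) α, Sample.app (t.mul u) l, l} ∪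
    ((F (Sample.app u α) ∪ G α) ∪ (F (Sample.app u l) ∪ G l)),
    (Set.toFinite _).union (((hFfin _).union (hGfin _)).union ((hFfin _).union (hGfin _))),
    by simp, ?_⟩
  have happ : ∀ δ γ, Step (Sample.app (t.mul u) δ) γ →
      γ = δ ∨ γ = Sample.app (t.mul u) l ∨ γ ∈ F (Sample.app u δ) := by
    intro δ γ h
    rcases step_app_cases h with rfl | rfl | ⟨t', u', e, rfl⟩ | ⟨u', e, -⟩
    · exact Or.inl rfl
    · exact Or.inr (Or.inl rfl)
    · obtain ⟨rfl, rfl⟩ := BasicTerm.mul_inj e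
      exact Or.inr (Or.inr (hFmem _))
    · exact absurd e BasicTerm.mul_ne_star
  rintro β ((rfl | rfl | rfl) | (h' | h') | (h' | h')) γ h
  · rcases happ _ _ h with rfl | rfl | h <;> simp [*]
  · rcases happ _ _ h with rfl | rfl | h <;> simp [*]
  · exact absurd h not_step_lst
  · rcases hFclosed _ _ h' _ h with h | rfl <;> simp [*]
  · rcases hGclosed _ _ h' _ h with h | rfl <;> simp [*]
  · rcases hFclosed _ _ h' _ h with h | rfl <;> simp [*]
  · rcases hGclosed _ _ h' _ h with h | rfl <;> simp [*]

theorem FinitelyUnfolds.star {t : BasicTerm} (ht : FinitelyUnfolds t) :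
    FinitelyUnfolds t.star := by
  choose F hFfin hFmem hFclosed using ht
  intro α
  let l := Sample.lst t.star
  let a := Sample.app t.star α
  let b := Sample.app t.star l
  refine ⟨{a, b, l, Sample.suc a, Sample.suc b} ∪
    ((F a ∪ F (Sample.suc a)) ∪ (F b ∪ F (Sample.suc b))),
    (Set.toFinite _).union (((hFfin _).union (hFfin _)).union ((hFfin _).union (hFfin _))),
    by simp [a], ?_⟩
  have happ : ∀ δ γ, Step (Sample.app t.star δ) γ →
      γ = δ ∨ γ = b ∨ γ ∈ F (Sample.app t.star δ) ∨
        γ ∈ F (Sample.suc (Sample.app t.star δ)) := by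
    intro δ γ h
    rcases step_app_cases h with rfl | rfl | ⟨t', u', e, rfl⟩ | ⟨u', e, rfl | rfl⟩
    · exact Or.inl rfl
    · exact Or.inr (Or.inl rfl)
    · exact absurd e.symm BasicTerm.mul_ne_star
    · obtain rfl := BasicTerm.star_inj e
      exact Or.inr (Or.inr (Or.inl (hFmem _)))
    · obtain rfl := BasicTerm.star_inj e
      exact Or.inr (Or.inr (Or.inr (hFmem _)))
  rintro β ((rfl | rfl | rfl | rfl | rfl) | (h' | h') | (h' | h')) γ h
  · rcases happ _ _ h with rfl | rfl | h | h <;> simp [a, h]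
  · rcases happ _ _ h with rfl | rfl | h | h <;> simp [b, h]
  · exact absurd h not_step_lst
  · simp [eq_of_step_suc h]
  · simp [eq_of_step_suc h]
  all_goals rcases hFclosed _ _ h' _ h with h | rfl <;> simp [*]

theorem finitelyUnfolds (t : BasicTerm) : FinitelyUnfolds t := by
  obtain ⟨t, ht⟩ := t
  induction ht with
  | var i =>
    exact finitelyUnfolds_of_irreducible
      (fun _ _ e => Term.noConfusion (congrArg Subtype.val e))
      (fun _ e => Term.noConfusion (congrArg Subtype.val e))
  | one =>
    exact finitelyUnfolds_of_irreducible
      (fun _ _ e => Term.noConfusion (congrArg Subtype.val e))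
      (fun _ e => Term.noConfusion (congrArg Subtype.val e))
  | mul _ _ iht ihu => exact iht.mul ihu
  | star _ iht => exact iht.star

theorem finite_reachable_of_closedUpTo {α β : Sample} {F : Set Sample} (hF : F.Finite)
    (hβ : β ∈ F) (hclosed : ClosedUpTo α F)
    (hα : {γ | Relation.ReflTransGen Step α γ}.Finite) :
    {γ | Relation.ReflTransGen Step β γ}.Finite := by
  refine (hF.union hα).subset fun γ h => ?_
  induction h with
  | refl => exact Or.inl hβ
  | tail _ hstep ih =>
    rcases ih with ih | ih
    · rcases hclosed _ ih _ hstep with h | rfl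
      · exact Or.inl h
      · exact Or.inr Relation.ReflTransGen.refl
    · exact Or.inr (Relation.ReflTransGen.tail ih hstep)

theorem finite_reachable_of_not_step {α : Sample} (h : ∀ γ, ¬ Step α γ) :
    {β | Relation.ReflTransGen Step α β}.Finite := by
  refine (Set.finite_singleton α).subset fun β hβ => ?_
  rcases hβ.cases_head with rfl | ⟨γ, hγ, -⟩
  · rfl
  · exact absurd hγ (h γ)

theorem finite_reachable (α : Sample) : {β | Relation.ReflTransGen Step α β}.Finite := by
  induction α with
  | kappa i => exact finite_reachable_of_not_step fun _ => not_step_kappa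
  | lst t => exact finite_reachable_of_not_step fun _ => not_step_lst
  | suc α ih =>
    refine finite_reachable_of_closedUpTo (Set.finite_singleton (Sample.suc α)) rfl ?_ ih
    rintro _ rfl γ h
    exact Or.inr (eq_of_step_suc h)
  | app t α ih =>
    obtain ⟨F, hF, hmem, hclosed⟩ := finitelyUnfolds t α
    exact finite_reachable_of_closedUpTo hF hmem hclosed ih

/-- The set of samples reachable from any given sample under `⤳*` is finite;
consequently, the saturation of any finite sample set is finite. -/
theorem stmt12 :
    (∀ α : Sample, {β | Relation.ReflTransGen Step α β}.Finite) ∧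
    ∀ Δ : Set Sample, Δ.Finite →
      {β | ∃ α ∈ Δ, Relation.ReflTransGen Step α β}.Finite := by
  refine ⟨finite_reachable, fun Δ hΔ => ?_⟩
  refine (hΔ.biUnion fun α _ => finite_reachable α).subset ?_
  rintro β ⟨α, hα, h⟩
  exact Set.mem_biUnion hα h
end

section
/- Let Δ be a finite saturated sample set and δ a Δ-diagram. Then there exists an assignment h : ℕ → W of time warps to variables such that eval h t (δ α) = δ (t[α]) for every sample of the form t[α] in Δ; moreover h can be chosen so that every h x is a regular time warp. -/
/-- Evaluation of a term under an assignment `h` of maps to variables. -/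
noncomputable def eval (h : ℕ → ℕ∞ → ℕ∞) : Term → ℕ∞ → ℕ∞
  | Term.var i => h i
  | Term.one => id
  | Term.mul t u => eval h t ∘ eval h u
  | Term.star t => winv (eval h t)
  | Term.meet t u => fun x => eval h t x ⊓ eval h u x
  | Term.join t u => fun x => eval h t x ⊔ eval h u x

/-- The saturation of a sample set: its closure under `⤳*`. -/
def saturation (Δ : Set Sample) : Set Sample :=
  {β | ∃ α ∈ Δ, Relation.ReflTransGen Step α β}

/-- A sample set is saturated if it is closed under `⤳`. -/
def Saturated (Δ : Set Sample) : Prop :=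
  ∀ α ∈ Δ, ∀ β : Sample, Step α β → β ∈ Δ

/-- The successor map `S` on `ℕ∞`: `S n = n + 1` for `n : ℕ` and `S ⊤ = ⊤`. -/
def eS (m : ℕ∞) : ℕ∞ := m + 1

/-- A `Δ`-diagram: a valuation of samples in `ℕ∞` satisfying conditions (1)–(12). -/
structure IsDiagram (Δ : Set Sample) (δ : Sample → ℕ∞) : Prop where
  mon : ∀ (t : BasicTerm) (α β : Sample), Sample.app t α ∈ Δ → Sample.app t β ∈ Δ →
    δ α ≤ δ β → δ (Sample.app t α) ≤ δ (Sample.app t β)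
  zero : ∀ (t : BasicTerm) (α : Sample), Sample.app t α ∈ Δ →
    δ α = 0 → δ (Sample.app t α) = 0
  suc_eq : ∀ α : Sample, Sample.suc α ∈ Δ → δ (Sample.suc α) = eS (δ α)
  last_iff : ∀ (t : BasicTerm) (α : Sample), Sample.app t α ∈ Δ →
    (δ (Sample.lst t) ≤ δ α ↔ δ (Sample.app t (Sample.lst t)) = δ (Sample.app t α))
  last_top : ∀ t : BasicTerm, Sample.app t (Sample.lst t) ∈ Δ →
    δ (Sample.lst t) = ⊤ → δ (Sample.app t (Sample.lst t)) = ⊤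
  one_eq : ∀ α : Sample, Sample.app BasicTerm.one α ∈ Δ →
    δ (Sample.app BasicTerm.one α) = δ α
  last_one : Sample.lst BasicTerm.one ∈ Δ → δ (Sample.lst BasicTerm.one) = ⊤
  mul_eq : ∀ (t u : BasicTerm) (α : Sample), Sample.app (t.mul u) α ∈ Δ →
    δ (Sample.app (t.mul u) α) = δ (Sample.app t (Sample.app u α))
  last_mul : ∀ t u : BasicTerm, Sample.lst (t.mul u) ∈ Δ → Sample.lst t ∈ Δ →
    Sample.lst u ∈ Δ → δ (Sample.lst (t.mul u)) = ⊤ →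
    δ (Sample.lst t) = ⊤ ∧ δ (Sample.lst u) = ⊤
  inv_lower : ∀ (t : BasicTerm) (α : Sample), Sample.app t.star α ∈ Δ →
    0 < δ α → δ α < ⊤ → δ (Sample.app t (Sample.app t.star α)) < δ α
  inv_upper : ∀ (t : BasicTerm) (α : Sample), Sample.app t.star α ∈ Δ →
    δ (Sample.app t.star α) < ⊤ →
    δ α ≤ δ (Sample.app t (Sample.suc (Sample.app t.star α)))
  inv_last : ∀ t : BasicTerm, Sample.lst t.star ∈ Δ → Sample.lst t ∈ Δ →
    δ (Sample.lst t.star) = ⊤ → δ (Sample.lst t) = ⊤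

theorem preservesSSup_of_monotone {f : ℕ∞ → ℕ∞} (hf : Monotone f) (h0 : f 0 = 0)
    (htop : f ⊤ ≤ ⨆ n : ℕ, f n) : PreservesSSup f := by
  intro S
  refine le_antisymm ?_ (sSup_le ?_)
  · rcases S.eq_empty_or_nonempty with rfl | hne
    · simp [h0]
    · rcases eq_or_ne (sSup S) ⊤ with hS | hS
      · rw [hS]
        refine htop.trans (iSup_le fun n => ?_)
        obtain ⟨s, hs, hns⟩ := lt_sSup_iff.1 (hS ▸ ENat.natCast_lt_top n : (n : ℕ∞) < sSup S)
        exact (hf hns.le).trans (le_sSup ⟨s, hs, rfl⟩)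
      · have := hne.to_subtype
        exact le_sSup ⟨_, ENat.sSup_mem_of_nonempty_of_lt_top hS.lt_top, rfl⟩
  · rintro _ ⟨s, hs, rfl⟩
    exact hf (le_sSup hs)

theorem wpred_top : wpred ⊤ = ⊤ := by simp [wpred]

theorem wpred_coe (n : ℕ) : wpred n = ((n - 1 : ℕ) : ℕ∞) := by simp [wpred]

theorem coe_le_wpred_of_lt {m : ℕ} {n : ℕ∞} (h : (m : ℕ∞) < n) : (m : ℕ∞) ≤ wpred n := by
  induction n using ENat.recTopCoe with
  | top => simp [wpred_top]
  | coe n =>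
    rw [wpred_coe]
    norm_cast at h ⊢
    omega

theorem monotone_winv (f : ℕ∞ → ℕ∞) : Monotone (winv f) := by
  intro a b hab
  refine sInf_le_sInf ?_
  rintro y ⟨n, hn, rfl⟩
  exact ⟨n, hab.trans hn, rfl⟩

theorem winv_zero (f : ℕ∞ → ℕ∞) : winv f 0 = 0 :=
  nonpos_iff_eq_zero.1 (sInf_le ⟨0, zero_le, by simpa using (wpred_coe 0).symm⟩)

theorem winv_le_coe {f : ℕ∞ → ℕ∞} {a : ℕ∞} {m : ℕ} (h : a ≤ f (m + 1)) : winv f a ≤ m :=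
  sInf_le ⟨_, h, by simpa using (wpred_coe (m + 1)).symm⟩

theorem coe_le_winv {f : ℕ∞ → ℕ∞} (hf : Monotone f) {a : ℕ∞} {m : ℕ} (h : f m < a) :
    (m : ℕ∞) ≤ winv f a := by
  refine le_sInf ?_
  rintro _ ⟨n, hn, rfl⟩
  refine coe_le_wpred_of_lt (lt_of_not_ge fun hnm => ?_)
  exact absurd (h.trans_le hn) (hf hnm).not_gt

theorem winv_eq_top_of_lt {f : ℕ∞ → ℕ∞} (hf : Monotone f) {a : ℕ∞} (h : f ⊤ < a) :
    winv f a = ⊤ := by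
  refine top_le_iff.1 (le_sInf ?_)
  rintro _ ⟨n, hn, rfl⟩
  exact absurd (h.trans_le hn) (hf le_top).not_gt

theorem winv_top_of_finite {f : ℕ∞ → ℕ∞} (h : ∀ n : ℕ, f n ≠ ⊤) : winv f ⊤ = ⊤ := by
  refine top_le_iff.1 (le_sInf ?_)
  rintro _ ⟨n, hn, rfl⟩
  induction n using ENat.recTopCoe with
  | top => rw [wpred_top]
  | coe n => exact absurd (top_le_iff.1 hn) (h n)

theorem monotone_eval {h : ℕ → ℕ∞ → ℕ∞} (hh : ∀ i, Monotone (h i)) {t : Term} (ht : IsBasic t) :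
    Monotone (eval h t) := by
  induction ht with
  | var i => exact hh i
  | one => exact monotone_id
  | mul _ _ iht ihu => exact iht.comp ihu
  | star _ _ => exact monotone_winv _

/-- `f` is finite and unbounded on `ℕ`; for a time warp this says that `last f = ⊤`. -/
def FiniteUnbounded (f : ℕ∞ → ℕ∞) : Prop :=
  (∀ n : ℕ, f n ≠ ⊤) ∧ ∀ n : ℕ, ∃ k : ℕ, (n : ℕ∞) ≤ f k

theorem finiteUnbounded_id : FiniteUnbounded id :=
  ⟨fun n => ENat.natCast_ne_top n, fun n => ⟨n, le_rfl⟩⟩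

theorem FiniteUnbounded.comp {f g : ℕ∞ → ℕ∞} (hf : FiniteUnbounded f) (hg : FiniteUnbounded g)
    (hmono : Monotone f) : FiniteUnbounded (f ∘ g) := by
  refine ⟨fun n => ?_, fun n => ?_⟩
  · obtain ⟨k, hk⟩ := ENat.ne_top_iff_exists.1 (hg.1 n)
    simpa [← hk] using hf.1 k
  · obtain ⟨k, hk⟩ := hf.2 n
    obtain ⟨l, hl⟩ := hg.2 k
    exact ⟨l, hk.trans (hmono hl)⟩

theorem FiniteUnbounded.winv {f : ℕ∞ → ℕ∞} (hf : FiniteUnbounded f) (hmono : Monotone f) :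
    FiniteUnbounded (winv f) := by
  refine ⟨fun n => ?_, fun n => ?_⟩
  · obtain ⟨k, hk⟩ := hf.2 n
    exact ne_top_of_le_ne_top (ENat.natCast_ne_top k)
      (winv_le_coe (hk.trans (hmono le_self_add)))
  · obtain ⟨k, hk⟩ := ENat.ne_top_iff_exists.1 (hf.1 n)
    refine ⟨k + 1, coe_le_winv hmono ?_⟩
    rw [← hk]
    exact_mod_cast k.lt_succ_self

/-- The least monotone map whose value at `δ α` is at least `δ t[α]` whenever `t[α] ∈ Δ`. -/
noncomputable def diagramStep (Δ : Set Sample) (δ : Sample → ℕ∞) (t : BasicTerm) (n : ℕ∞) : ℕ∞ :=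
  sSup {y | ∃ α, Sample.app t α ∈ Δ ∧ δ α ≤ n ∧ y = δ (Sample.app t α)}

section Diagram

variable {Δ : Set Sample} {δ : Sample → ℕ∞}

theorem monotone_diagramStep (t : BasicTerm) : Monotone (diagramStep Δ δ t) := by
  intro a b hab
  refine sSup_le_sSup ?_
  rintro y ⟨α, hα, hle, rfl⟩
  exact ⟨α, hα, hle.trans hab, rfl⟩

theorem IsDiagram.diagramStep_apply (hδ : IsDiagram Δ δ) {t : BasicTerm} {α : Sample}
    (hα : Sample.app t α ∈ Δ) : diagramStep Δ δ t (δ α) = δ (Sample.app t α) := by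
  refine le_antisymm (sSup_le ?_) (le_sSup ⟨α, hα, le_rfl, rfl⟩)
  rintro y ⟨β, hβ, hle, rfl⟩
  exact hδ.mon t β α hβ hα hle

theorem IsDiagram.diagramStep_zero (hδ : IsDiagram Δ δ) (t : BasicTerm) :
    diagramStep Δ δ t 0 = 0 := by
  refine nonpos_iff_eq_zero.1 (sSup_le ?_)
  rintro y ⟨β, hβ, hle, rfl⟩
  exact (hδ.zero t β hβ (nonpos_iff_eq_zero.1 hle)).le

theorem IsDiagram.diagramStep_le_last (hδ : IsDiagram Δ δ) {t : BasicTerm}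
    (hlast : Sample.app t (Sample.lst t) ∈ Δ) (n : ℕ∞) :
    diagramStep Δ δ t n ≤ diagramStep Δ δ t (δ (Sample.lst t)) := by
  rw [hδ.diagramStep_apply hlast]
  refine sSup_le ?_
  rintro y ⟨β, hβ, -, rfl⟩
  rcases le_total (δ β) (δ (Sample.lst t)) with h | h
  · exact hδ.mon t β _ hβ hlast h
  · exact ((hδ.last_iff t β hβ).1 h).ge

/-- If `δ (last t) = ⊤`, then `δ t[α]` is finite whenever `δ α` is. -/
theorem IsDiagram.app_ne_top (hδ : IsDiagram Δ δ) {t : BasicTerm} {α : Sample}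
    (hα : Sample.app t α ∈ Δ) (hlast : Sample.app t (Sample.lst t) ∈ Δ)
    (htop : δ (Sample.lst t) = ⊤) (hfin : δ α ≠ ⊤) : δ (Sample.app t α) ≠ ⊤ := by
  intro h
  have := (hδ.last_iff t α hα).2 (by rw [hδ.last_top t hlast htop, h])
  exact hfin (top_le_iff.1 (htop ▸ this))

theorem exists_bound_of_finite (hfin : Δ.Finite) (δ : Sample → ℕ∞) :
    ∃ N : ℕ, ∀ β ∈ Δ, δ β ≠ ⊤ → δ β ≤ N := by
  obtain ⟨N, hN⟩ := (hfin.image fun β => (δ β).toNat).bddAbove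
  refine ⟨N, fun β hβ hne => ?_⟩
  rw [← ENat.natCast_toNat hne]
  exact_mod_cast hN ⟨β, hβ, rfl⟩

/-- Every basic term can be interpreted by a regular time warp agreeing with the diagram. -/
theorem IsDiagram.exists_regular_extension (hδ : IsDiagram Δ δ) (hfin : Δ.Finite)
    (hsat : Saturated Δ) (t : BasicTerm) :
    ∃ f : ℕ∞ → ℕ∞, PreservesSSup f ∧ RegularW f ∧ Monotone f ∧
      (∀ α, Sample.app t α ∈ Δ → f (δ α) = δ (Sample.app t α)) ∧
      ((∃ α, Sample.app t α ∈ Δ) → δ (Sample.lst t) = ⊤ → FiniteUnbounded f) := by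
  by_cases hex : ∃ α, Sample.app t α ∈ Δ
  swap
  · refine ⟨id, fun S => by simp, Or.inr ⟨0, 0, fun n _ => ⟨n, rfl, by simp⟩⟩, monotone_id,
      fun α hα => absurd ⟨α, hα⟩ hex, fun h => absurd h hex⟩
  have hlast : Sample.app t (Sample.lst t) ∈ Δ :=
    hex.elim fun α hα => hsat _ hα _ (Step.toLast t α)
  have hg : Monotone (diagramStep Δ δ t) := monotone_diagramStep t
  by_cases htop : δ (Sample.lst t) = ⊤
  · obtain ⟨N, hN⟩ := exists_bound_of_finite hfin δ
    have hgN : ∀ n : ℕ, diagramStep Δ δ t n ≤ N := by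
      refine fun n => sSup_le ?_
      rintro y ⟨β, hβ, hle, rfl⟩
      exact hN _ hβ (hδ.app_ne_top hβ hlast htop (ne_top_of_le_ne_top (ENat.natCast_ne_top n) hle))
    have hmono : Monotone fun n => diagramStep Δ δ t n ⊔ (n - (N : ℕ∞)) := fun a b hab =>
      sup_le_sup (hg hab) (tsub_le_tsub_right hab _)
    have hunb : ∀ n : ℕ, ∃ k : ℕ, (n : ℕ∞) ≤ diagramStep Δ δ t k ⊔ ((k : ℕ∞) - (N : ℕ∞)) := by
      refine fun n => ⟨n + N, le_sup_of_le_right ?_⟩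
      norm_cast
      omega
    refine ⟨fun n => diagramStep Δ δ t n ⊔ (n - (N : ℕ∞)), preservesSSup_of_monotone hmono ?_ ?_,
      Or.inr ⟨N + N, -N, fun n hn => ⟨n - N, ?_, by omega⟩⟩, hmono, fun α hα => ?_,
      fun _ _ => ⟨fun n => ?_, hunb⟩⟩
    · simp [hδ.diagramStep_zero]
    · refine le_top.trans (top_le_iff.2 (ENat.eq_top_iff_forall_ge.2 fun n => ?_))
      obtain ⟨k, hk⟩ := hunb n
      exact hk.trans (le_iSup (fun k : ℕ => diagramStep Δ δ t k ⊔ ((k : ℕ∞) - (N : ℕ∞))) k)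
    · have h : (N : ℕ∞) ≤ ((n - N : ℕ) : ℕ∞) := by
        norm_cast
        omega
      simpa using (hgN n).trans h
    · change diagramStep Δ δ t (δ α) ⊔ (δ α - (N : ℕ∞)) = _
      rw [hδ.diagramStep_apply hα, sup_eq_left]
      by_cases hα' : δ α = ⊤
      · rw [← (hδ.last_iff t α hα).1 (hα' ▸ le_top), hδ.last_top t hlast htop]
        exact le_top
      · rw [tsub_eq_zero_of_le (hN α (hsat _ hα _ (Step.appDrop t α)) hα')]
        exact zero_le
    · refine ne_top_of_le_ne_top (ENat.natCast_ne_top (N + n)) (sup_le ((hgN n).trans ?_) ?_)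
      · exact_mod_cast Nat.le_add_right N n
      · norm_cast
        omega
  · obtain ⟨l, hl⟩ := ENat.ne_top_iff_exists.1 htop
    have hle : ∀ n, diagramStep Δ δ t n ≤ diagramStep Δ δ t l :=
      fun n => hl ▸ hδ.diagramStep_le_last hlast n
    exact ⟨diagramStep Δ δ t, preservesSSup_of_monotone hg (hδ.diagramStep_zero t)
      ((hle ⊤).trans (le_iSup (fun n : ℕ => diagramStep Δ δ t n) l)),
      Or.inl ⟨l, fun n hn => le_antisymm (hle n) (hg (by exact_mod_cast hn))⟩, hg,
      fun α hα => hδ.diagramStep_apply hα, fun _ h => absurd h htop⟩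

/-- A monotone map agreeing with the diagram on `t` has an involution agreeing with the
diagram on `t⋆`. -/
theorem IsDiagram.winv_apply (hδ : IsDiagram Δ δ) (hsat : Saturated Δ) {t : BasicTerm}
    {f : ℕ∞ → ℕ∞} (hmono : Monotone f)
    (hf : ∀ α, Sample.app t α ∈ Δ → f (δ α) = δ (Sample.app t α))
    (hlast : (∃ α, Sample.app t α ∈ Δ) → δ (Sample.lst t) = ⊤ → FiniteUnbounded f)
    {α : Sample} (hα : Sample.app t.star α ∈ Δ) :
    winv f (δ α) = δ (Sample.app t.star α) := by
  have hlow : ∀ β, Sample.app t.star β ∈ Δ → δ β ≠ 0 → δ β ≠ ⊤ →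
      f (δ (Sample.app t.star β)) < δ β := by
    intro β hβ h0 h1
    rw [hf _ (hsat _ hβ _ (Step.starLow t β))]
    exact hδ.inv_lower t β hβ (pos_iff_ne_zero.2 h0) h1.lt_top
  have hup : ∀ m : ℕ, (m : ℕ∞) = δ (Sample.app t.star α) → δ α ≤ f (m + 1) := by
    intro m hm
    have hmem := hsat _ hα _ (Step.starHigh t α)
    have hsuc := hδ.suc_eq _ (hsat _ hmem _ (Step.appDrop _ _))
    have := hδ.inv_upper t α hα (hm ▸ ENat.natCast_lt_top m)
    rwa [← hf _ hmem, hsuc, ← hm] at this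
  by_cases h0 : δ α = 0
  · rw [hδ.zero _ α hα h0, h0, winv_zero]
  have hL := hsat _ hα _ (Step.toLast t.star α)
  have hLt := hsat _ hα _ (Step.starLow t α)
  by_cases h1 : δ α = ⊤
  · have hLα := (hδ.last_iff t.star α hα).1 (h1 ▸ le_top)
    by_cases hm : δ (Sample.app t.star α) = ⊤
    · rw [hm, h1]
      by_cases hb : δ (Sample.lst t.star) = ⊤
      · have htop := hδ.inv_last t (hsat _ hL _ (Step.appDrop _ _))
          (hsat _ (hsat _ hLt _ (Step.toLast _ _)) _ (Step.appDrop _ _)) hb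
        exact winv_top_of_finite (hlast ⟨_, hLt⟩ htop).1
      · by_cases hb0 : δ (Sample.lst t.star) = 0
        · rw [hδ.zero _ _ hL hb0, hm] at hLα
          simp at hLα
        · have := hlow _ hL hb0 hb
          rw [hLα, hm] at this
          exact winv_eq_top_of_lt hmono (this.trans_le le_top)
    · obtain ⟨m, hm'⟩ := ENat.ne_top_iff_exists.1 hm
      rw [← hm']
      refine le_antisymm (winv_le_coe (hup m hm')) ?_
      by_cases hb0 : δ (Sample.lst t.star) = 0
      · rw [hδ.zero _ _ hL hb0, ← hm'] at hLα
        rw [← hLα]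
        exact zero_le
      · have hb : δ (Sample.lst t.star) ≠ ⊤ := fun hb =>
          hm (hLα ▸ hδ.last_top _ hL hb)
        have := hlow _ hL hb0 hb
        rw [hLα, ← hm'] at this
        exact coe_le_winv hmono (h1 ▸ this.trans_le le_top)
  · have hlt := hlow α hα h0 h1
    by_cases hm : δ (Sample.app t.star α) = ⊤
    · rw [hm] at hlt ⊢
      exact winv_eq_top_of_lt hmono hlt
    · obtain ⟨m, hm'⟩ := ENat.ne_top_iff_exists.1 hm
      rw [← hm'] at hlt ⊢
      exact le_antisymm (winv_le_coe (hup m hm')) (coe_le_winv hmono hlt)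

/-- An assignment agreeing with the diagram on variables agrees with it on all basic terms. -/
theorem IsDiagram.eval_apply (hδ : IsDiagram Δ δ) (hsat : Saturated Δ) {h : ℕ → ℕ∞ → ℕ∞}
    (hmono : ∀ i, Monotone (h i))
    (happ : ∀ i α, Sample.app ⟨Term.var i, IsBasic.var i⟩ α ∈ Δ →
      h i (δ α) = δ (Sample.app ⟨Term.var i, IsBasic.var i⟩ α))
    (hlast : ∀ i, (∃ α, Sample.app ⟨Term.var i, IsBasic.var i⟩ α ∈ Δ) →
      δ (Sample.lst ⟨Term.var i, IsBasic.var i⟩) = ⊤ → FiniteUnbounded (h i))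
    {t : Term} (ht : IsBasic t) :
    (∀ α, Sample.app ⟨t, ht⟩ α ∈ Δ → eval h t (δ α) = δ (Sample.app ⟨t, ht⟩ α)) ∧
      ((∃ α, Sample.app ⟨t, ht⟩ α ∈ Δ) → δ (Sample.lst ⟨t, ht⟩) = ⊤ →
        FiniteUnbounded (eval h t)) := by
  have lst_mem : ∀ (t : BasicTerm) (α : Sample), Sample.app t α ∈ Δ → Sample.lst t ∈ Δ :=
    fun t α hα => hsat _ (hsat _ hα _ (Step.toLast t α)) _ (Step.appDrop _ _)
  induction ht with
  | var i => exact ⟨happ i, hlast i⟩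
  | one => exact ⟨fun α hα => (hδ.one_eq α hα).symm, fun _ _ => finiteUnbounded_id⟩
  | @mul t u ht hu iht ihu =>
    have hsplit : ∀ α, Sample.app (BasicTerm.mul ⟨t, ht⟩ ⟨u, hu⟩) α ∈ Δ →
        Sample.app ⟨t, ht⟩ (Sample.app ⟨u, hu⟩ α) ∈ Δ ∧ Sample.app ⟨u, hu⟩ α ∈ Δ := fun α hα =>
      have h := hsat _ hα _ (Step.mulSplit ⟨t, ht⟩ ⟨u, hu⟩ α)
      ⟨h, hsat _ h _ (Step.appDrop _ _)⟩
    refine ⟨fun α hα => ?_, ?_⟩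
    · obtain ⟨h1, h2⟩ := hsplit α hα
      refine Eq.trans ?_ (hδ.mul_eq ⟨t, ht⟩ ⟨u, hu⟩ α hα).symm
      rw [← iht.1 _ h1, ← ihu.1 _ h2]
      rfl
    · rintro ⟨α, hα⟩ htop
      obtain ⟨h1, h2⟩ := hsplit α hα
      obtain ⟨h3, h4⟩ := hδ.last_mul ⟨t, ht⟩ ⟨u, hu⟩ (lst_mem _ _ hα) (lst_mem _ _ h1)
        (lst_mem _ _ h2) htop
      exact (iht.2 ⟨_, h1⟩ h3).comp (ihu.2 ⟨_, h2⟩ h4) (monotone_eval hmono ht)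
  | @star t ht iht =>
    refine ⟨fun α hα => hδ.winv_apply hsat (monotone_eval hmono ht) iht.1 iht.2 hα, ?_⟩
    rintro ⟨α, hα⟩ htop
    have h1 := hsat _ hα _ (Step.starLow ⟨t, ht⟩ α)
    exact (iht.2 ⟨_, h1⟩ (hδ.inv_last ⟨t, ht⟩ (lst_mem _ _ hα) (lst_mem _ _ h1) htop)).winv
      (monotone_eval hmono ht)

end Diagram

/-- Every diagram on a finite saturated sample set is realized by an assignment of
(regular) time warps to variables. -/
theorem stmt15 (Δ : Set Sample) (hfin : Δ.Finite) (hsat : Saturated Δ)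
    (δ : Sample → ℕ∞) (hδ : IsDiagram Δ δ) :
    ∃ h : ℕ → ℕ∞ → ℕ∞, (∀ i, PreservesSSup (h i) ∧ RegularW (h i)) ∧
      ∀ (t : BasicTerm) (α : Sample), Sample.app t α ∈ Δ →
        eval h t.1 (δ α) = δ (Sample.app t α) := by
  choose h hsup hreg hmono happ hlast using fun i : ℕ =>
    hδ.exists_regular_extension hfin hsat ⟨Term.var i, IsBasic.var i⟩
  exact ⟨h, fun i => ⟨hsup i, hreg i⟩, fun t α hα =>
    (hδ.eval_apply hsat hmono happ hlast t.2).1 α hα⟩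
end
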